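/- (Quantum-classical correspondence for exceptional and regular parameters.) Let G = (X,E) be a finite connected graph without dead ends and z ∈ ℂ ∖ {0}. Then the eigenspace E_z(Δᵉ; Maps(E,ℂ)) of the edge Laplacian is linearly isomorphic to the eigenspace E_z(L; C^lc(𝔓)) of the transfer operator, and both are linearly isomorphic to E_z(L'; D'(𝔓)). -/

import Mathlib

open Function Set
open scoped Classical

namespace GraphQCC

variable {X : Type} (G : SimpleGraph X)

/-- The set of directed edges of a (symmetric, loopless) graph. -/
abbrev DE := {p : X × X // G.Adj p.1 p.2}

variable {G}

/-- Initial vertex of a directed edge. -/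
def ini (e : DE G) : X := e.1.1

/-- Terminal vertex of a directed edge. -/
def ter (e : DE G) : X := e.1.2

/-- Opposite edge. -/
def op (e : DE G) : DE G := ⟨(e.1.2, e.1.1), e.2.symm⟩

variable (G)

/-- Degree of a vertex: the number of directed edges starting at it. -/
noncomputable def deg (x : X) : ℕ := Set.ncard {e : DE G | ini e = x}

/-- The graph is locally finite: every vertex has finite degree. -/
def LocFin : Prop := ∀ x : X, {e : DE G | ini e = x}.Finite

/-- The edge Laplacian. -/
noncomputable def edgeLap (f : DE G → ℂ) (e : DE G) : ℂ :=
  ∑ᶠ e' ∈ {e' : DE G | ini e' = ter e ∧ e' ≠ op e}, f e'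

/-- The `z`-eigenspace of the edge Laplacian, as a set of functions on directed edges. -/
def edgeEig (z : ℂ) : Set (DE G → ℂ) := {f | ∀ e, edgeLap G f e = z * f e}

/-- The edge inversion operator Ξ. -/
def Xi (f : DE G → ℂ) (e : DE G) : ℂ := f (op e)

/-- The operator Σ (sum over edges with the same initial point). -/
noncomputable def Sig (f : DE G → ℂ) (e : DE G) : ℂ :=
  ∑ᶠ e' ∈ {e' : DE G | ini e' = ini e}, f e'

/-- Edges pointing away from a vertex `o`. -/
def away (o : X) : Set (DE G) := {e | G.dist o (ter e) = G.dist o (ini e) + 1}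

/-- The edge Laplacian on functions on the edges pointing away from `o`. -/
noncomputable def edgeLapAway (o : X) (f : ↥(away G o) → ℂ) (e : ↥(away G o)) : ℂ :=
  ∑ᶠ e' ∈ {e' : ↥(away G o) | ini e'.1 = ter e.1 ∧ e'.1 ≠ op e.1}, f e'

/-- The `z`-eigenspace of the edge Laplacian on edges pointing away from `o`. -/
def edgeEigAway (o : X) (z : ℂ) : Set (↥(away G o) → ℂ) :=
  {f | ∀ e, edgeLapAway G o f e = z * f e}

/-! ## Boundary at infinity -/

/-- A ray: an infinite non-backtracking chain of vertices. -/
def IsRay (r : ℕ → X) : Prop := (∀ n, G.Adj (r n) (r (n + 1))) ∧ ∀ n, r (n + 2) ≠ r n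

abbrev Ray := {r : ℕ → X // IsRay G r}

/-- Two rays are equivalent if they share infinitely many vertices. -/
def RayRel (r r' : Ray G) : Prop := (Set.range r.1 ∩ Set.range r'.1).Infinite

/-- The boundary at infinity: equivalence classes of rays. -/
def Boundary := Quot (RayRel G)

/-- The set `∂₊ e` of boundary points reachable by a non-backtracking chain starting with `e`. -/
def plusBd (e : DE G) : Set (Boundary G) :=
  {ω | ∃ r : Ray G, Quot.mk (RayRel G) r = ω ∧ r.1 0 = ini e ∧ r.1 1 = ter e}

/-- The topology on the boundary generated by the sets `∂₊ e`. -/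
instance : TopologicalSpace (Boundary G) :=
  TopologicalSpace.generateFrom {s | ∃ e : DE G, s = plusBd G e}

/-- The space of locally constant functions on the boundary. -/
noncomputable def Clc : Submodule ℂ (Boundary G → ℂ) where
  carrier := {f | IsLocallyConstant f}
  add_mem' hf hg := hf.comp₂ hg (· + ·)
  zero_mem' := IsLocallyConstant.const 0
  smul_mem' c f hf := hf.comp (c * ·)

/-- `D'(Ω)`: the algebraic dual of the space of locally constant functions on the boundary. -/
abbrev DualB := Module.Dual ℂ ↥(Clc G)

/-- Pairing of a functional on `C^lc(Ω)` with a function on the boundary. -/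
noncomputable def pairB (μ : DualB G) (g : Boundary G → ℂ) : ℂ :=
  if h : IsLocallyConstant g then μ ⟨g, h⟩ else 0

/-- The horocycle bracket `⟨x, ω⟩` with respect to the base point `o`: the unique integer `k`
such that `d(x, r n) = n - k` for every ray `r` from `o` representing `ω` and all large `n`. -/
noncomputable def horo (o x : X) (ω : Boundary G) : ℤ :=
  if h : ∃ k : ℤ, ∀ r : Ray G, Quot.mk (RayRel G) r = ω → r.1 0 = o →
      ∃ N : ℕ, ∀ n : ℕ, N ≤ n → (G.dist x (r.1 n) : ℤ) = (n : ℤ) - k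
  then h.choose else 0

/-- The scalar Poisson transform. -/
noncomputable def poisson (o : X) (z : ℂ) (μ : DualB G) (x : X) : ℂ :=
  pairB G μ fun ω => z ^ horo G o x ω

/-- The edge Poisson transform. -/
noncomputable def edgePoisson (o : X) (z : ℂ) (μ : DualB G) (e : DE G) : ℂ :=
  pairB G μ fun ω => z ^ horo G o (ini e) ω * Set.indicator (plusBd G e) 1 ω

/-! ## The shift space of non-backtracking chains of edges -/

/-- An infinite concatenated non-backtracking sequence of directed edges. -/
def IsChainSeq (c : ℕ → DE G) : Prop :=
  ∀ i, ter (c i) = ini (c (i + 1)) ∧ ter (c (i + 1)) ≠ ini (c i)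

/-- The shift space `𝔓`. -/
abbrev ChainSp := {c : ℕ → DE G // IsChainSeq G c}

/-- The one-sided shift on chains. -/
def shift (c : ChainSp G) : ChainSp G := ⟨fun n => c.1 (n + 1), fun i => c.2 (i + 1)⟩

/-- The district (cylinder) topology on the shift space. -/
instance : TopologicalSpace (ChainSp G) :=
  TopologicalSpace.generateFrom
    {s | ∃ (c₀ : ChainSp G) (n : ℕ), s = {c : ChainSp G | ∀ i ≤ n, c.1 i = c₀.1 i}}

/-- The Ruelle transfer operator. -/
noncomputable def transfer (F : ChainSp G → ℂ) (c : ChainSp G) : ℂ :=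
  ∑ᶠ c' ∈ {c' : ChainSp G | shift G c' = c}, F c'

/-- Functions on chains depending only on the first `N` edges. -/
def cylFun (N : ℕ) : Set (ChainSp G → ℂ) :=
  {F | ∀ c c' : ChainSp G, (∀ i < N, c.1 i = c'.1 i) → F c = F c'}

/-- The ray of initial vertices of a chain of edges. -/
def toRay (c : ChainSp G) : Ray G :=
  ⟨fun n => ini (c.1 n), by
    refine ⟨fun n => ?_, fun n => ?_⟩
    · have h1 : ter (c.1 n) = ini (c.1 (n + 1)) := (c.2 n).1
      have h2 : G.Adj (ini (c.1 n)) (ter (c.1 n)) := (c.1 n).2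
      rwa [h1] at h2
    · have h1 : ter (c.1 (n + 1)) = ini (c.1 (n + 2)) := (c.2 (n + 1)).1
      have h2 : ter (c.1 (n + 1)) ≠ ini (c.1 n) := (c.2 n).2
      rwa [h1] at h2⟩

/-- The endpoint map `B : 𝔓 → Ω`. -/
def endB (c : ChainSp G) : Boundary G := Quot.mk (RayRel G) (toRay G c)

/-- The pushforward `B_⋆` by fiber summation. -/
noncomputable def push (f : ChainSp G → ℂ) (ω : Boundary G) : ℂ :=
  ∑ᶠ c ∈ {c : ChainSp G | endB G c = ω}, f c

/-- The space of locally constant compactly supported functions on the shift space. -/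
noncomputable def CcP : Submodule ℂ (ChainSp G → ℂ) where
  carrier := {F | IsLocallyConstant F ∧ HasCompactSupport F}
  add_mem' hf hg := ⟨hf.1.comp₂ hg.1 (· + ·), hf.2.add hg.2⟩
  zero_mem' := ⟨IsLocallyConstant.const 0, HasCompactSupport.zero⟩
  smul_mem' c f hf := ⟨hf.1.comp (c * ·),
    hf.2.mono fun x hx h0 => hx (by simp [h0])⟩

/-- `D'(𝔓)`: the algebraic dual of `C^lc_c(𝔓)`. -/
abbrev DualP := Module.Dual ℂ ↥(CcP G)

/-- Pairing of a functional on `C^lc_c(𝔓)` with a function on the shift space. -/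
noncomputable def pairP (lam : DualP G) (g : ChainSp G → ℂ) : ℂ :=
  if h : g ∈ CcP G then lam ⟨g, h⟩ else 0

/-- The space of locally constant functions on the shift space (for finite graphs this is
`C^lc_c(𝔓)` since `𝔓` is compact). -/
noncomputable def ClcP : Submodule ℂ (ChainSp G → ℂ) where
  carrier := {F | IsLocallyConstant F}
  add_mem' hf hg := hf.comp₂ hg (· + ·)
  zero_mem' := IsLocallyConstant.const 0
  smul_mem' c f hf := hf.comp (c * ·)

/-- The dual of `C^lc(𝔓)`. -/
abbrev DualPc := Module.Dual ℂ ↥(ClcP G)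

/-- Pairing of a functional on `C^lc(𝔓)` with a function on the shift space. -/
noncomputable def pairPc (lam : DualPc G) (g : ChainSp G → ℂ) : ℂ :=
  if h : IsLocallyConstant g then lam ⟨g, h⟩ else 0

/-! ## Vertex Laplacian -/

/-- The vertex Laplacian (averaging over neighbors). -/
noncomputable def vertexLap (f : X → ℂ) (x : X) : ℂ :=
  ((deg G x : ℂ))⁻¹ * ∑ᶠ e ∈ {e : DE G | ini e = x}, f (ter e)

/-- The function `χ(z)(x) = (z + q_x z⁻¹)/(q_x + 1)`. -/
noncomputable def chi (z : ℂ) (x : X) : ℂ :=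
  (z + ((deg G x : ℂ) - 1) * z⁻¹) / (deg G x : ℂ)

/-- The `χ(z)`-eigenspace of the vertex Laplacian. -/
def vertexEig (z : ℂ) : Set (X → ℂ) := {f | ∀ x, vertexLap G f x = chi G z x * f x}

/-! ## Miscellaneous -/

/-- Two subsets of complex vector spaces (in practice: subspaces) are linearly isomorphic. -/
def AreLinIso {M N : Type} [AddCommMonoid M] [Module ℂ M] [AddCommMonoid N] [Module ℂ N]
    (A : Set M) (B : Set N) : Prop :=
  ∃ F : M → N, Set.BijOn F A B ∧ (∀ a ∈ A, ∀ b ∈ A, F (a + b) = F a + F b) ∧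
    ∀ (c : ℂ), ∀ a ∈ A, F (c • a) = c • F a

/-- The `z`-eigenspace of the edge Laplacian as a submodule (for a locally finite graph). -/
noncomputable def edgeEigSub (hlf : LocFin G) (z : ℂ) : Submodule ℂ (DE G → ℂ) where
  carrier := edgeEig G z
  add_mem' := by
    intro f g hf hg e
    have hS : {e' : DE G | ini e' = ter e ∧ e' ≠ op e}.Finite :=
      (hlf (ter e)).subset fun _ h => h.1
    have : edgeLap G (f + g) e = edgeLap G f e + edgeLap G g e := by
      simpa [edgeLap] using finsum_mem_add_distrib (f := f) (g := g) hS
    rw [this, hf e, hg e, Pi.add_apply, mul_add]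
  zero_mem' := by
    intro e
    simp [edgeLap]
  smul_mem' := by
    intro c f hf e
    have hS : {e' : DE G | ini e' = ter e ∧ e' ≠ op e}.Finite :=
      (hlf (ter e)).subset fun _ h => h.1
    have : edgeLap G (c • f) e = c * edgeLap G f e := by
      simp only [edgeLap, Pi.smul_apply, smul_eq_mul]
      rw [finsum_mem_eq_finite_toFinset_sum _ hS, finsum_mem_eq_finite_toFinset_sum _ hS,
        Finset.mul_sum]
    rw [Pi.smul_apply, smul_eq_mul, this, hf e]; ring

/-- The cyclomatic number of a finite graph, as an integer. -/
noncomputable def cyclo : ℤ := (Nat.card G.edgeSet : ℤ) - (Nat.card X : ℤ) + 1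

/-- 2-colorability. -/
def TwoColorable : Prop := ∃ col : X → Bool, ∀ x y : X, G.Adj x y → col x ≠ col y

/-- `Follows e e'` holds if `e e'` is a non-backtracking chain. -/
def Follows (e e' : DE G) : Prop := ter e = ini e' ∧ ter e' ≠ ini e

variable {G}

@[simp] lemma op_op (e : DE G) : op (op e) = e := rfl

lemma follows_op_op {e e' : DE G} : Follows G (op e') (op e) ↔ Follows G e e' :=
  and_congr eq_comm ne_comm

lemma eq_op_iff {e e' : DE G} (h : ini e' = ter e) : e' = op e ↔ ter e' = ini e := by
  refine ⟨fun h' => by rw [h']; rfl, fun h' => Subtype.ext (Prod.ext h h')⟩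

lemma edgeLap_eq_sum [Fintype (DE G)] (f : DE G → ℂ) (e : DE G) :
    edgeLap G f e = ∑ e' with Follows G e e', f e' := by
  have hset : {e' : DE G | ini e' = ter e ∧ e' ≠ op e} =
      ((Finset.univ.filter fun e' => Follows G e e' : Finset (DE G)) : Set (DE G)) := by
    ext e'
    simp only [Finset.coe_filter, Finset.mem_univ, true_and]
    exact (and_congr_right fun h => not_congr (eq_op_iff h)).trans (and_congr_left' eq_comm)
  rw [edgeLap, hset, finsum_mem_coe_finset]

/-- Prepend an edge to a chain; the chain is returned unchanged if this is impossible. -/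
noncomputable def cons (e : DE G) (c : ChainSp G) : ChainSp G :=
  if h : Follows G e (c.1 0) then
    ⟨fun n => Nat.casesOn n e c.1, fun i => by
      cases i with
      | zero => exact h
      | succ i => exact c.2 i⟩
  else c

lemma cons_zero {e : DE G} {c : ChainSp G} (h : Follows G e (c.1 0)) : (cons e c).1 0 = e := by
  rw [cons, dif_pos h]
  rfl

lemma cons_succ {e : DE G} {c : ChainSp G} (h : Follows G e (c.1 0)) (n : ℕ) :
    (cons e c).1 (n + 1) = c.1 n := by
  rw [cons, dif_pos h]

lemma transfer_eq_sum [Fintype (DE G)] (F : ChainSp G → ℂ) (c : ChainSp G) :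
    transfer G F c = ∑ e with Follows G e (c.1 0), F (cons e c) := by
  rw [transfer, ← finsum_mem_coe_finset]
  refine (finsum_mem_eq_of_bijOn (fun e => cons e c) ⟨?_, ?_, ?_⟩ fun _ _ => rfl).symm
  · intro e he
    have he : Follows G e (c.1 0) := by simpa using he
    exact Subtype.ext (funext fun n => cons_succ he n)
  · intro e he e' he' h
    have he : Follows G e (c.1 0) := by simpa using he
    have he' : Follows G e' (c.1 0) := by simpa using he'
    rw [← cons_zero he, ← cons_zero he']
    exact congrArg (fun d : ChainSp G => d.1 0) h
  · rintro d rfl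
    have hd : Follows G (d.1 0) ((shift G d).1 0) := d.2 0
    refine ⟨d.1 0, by simpa using hd, Subtype.ext (funext fun n => ?_)⟩
    cases n with
    | zero => exact cons_zero hd
    | succ n => exact cons_succ hd n

lemma exists_follows (hnd : ∀ x : X, 2 ≤ deg G x) (e : DE G) : ∃ e', Follows G e e' := by
  obtain ⟨e', h, hne⟩ := Set.exists_ne_of_one_lt_ncard (hnd (ter e)) (op e)
  exact ⟨e', Eq.symm h, fun h' => hne ((eq_op_iff h).2 h')⟩

lemma exists_chain (hnd : ∀ x : X, 2 ≤ deg G x) (e : DE G) : ∃ c : ChainSp G, c.1 0 = e := by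
  choose next hnext using exists_follows hnd
  exact ⟨⟨fun n => next^[n] e, fun i => by
    simpa only [Function.iterate_succ_apply', Follows] using hnext (next^[i] e)⟩, rfl⟩

lemma cylFun_mono {M N : ℕ} (h : M ≤ N) : cylFun G M ⊆ cylFun G N :=
  fun _ hF c c' hc => hF c c' fun i hi => hc i (hi.trans_le h)

lemma isLocallyConstant_of_mem_cylFun {N : ℕ} {F : ChainSp G → ℂ} (hF : F ∈ cylFun G N) :
    IsLocallyConstant F := by
  rw [IsLocallyConstant.iff_exists_open]
  exact fun c => ⟨{c' | ∀ i ≤ N, c'.1 i = c.1 i},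
    TopologicalSpace.isOpen_generateFrom_of_mem ⟨c, N, rfl⟩, fun _ _ => rfl,
    fun c' hc' => hF c' c fun i hi => hc' i hi.le⟩

lemma exists_cylinder_subset {U : Set (ChainSp G)} (hU : IsOpen U) {c : ChainSp G}
    (hc : c ∈ U) : ∃ n, ∀ c' : ChainSp G, (∀ i < n, c'.1 i = c.1 i) → c' ∈ U := by
  induction hU with
  | basic s hs =>
    obtain ⟨c₀, n, rfl⟩ := hs
    exact ⟨n + 1, fun c' h i hi => (h i (Nat.lt_succ_of_le hi)).trans (hc i hi)⟩
  | univ => exact ⟨0, fun _ _ => trivial⟩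
  | inter s t _ _ ihs iht =>
    obtain ⟨m, hm⟩ := ihs hc.1
    obtain ⟨n, hn⟩ := iht hc.2
    exact ⟨max m n, fun c' h => ⟨hm c' fun i hi => h i (lt_max_of_lt_left hi),
      hn c' fun i hi => h i (lt_max_of_lt_right hi)⟩⟩
  | sUnion S _ ih =>
    obtain ⟨s, hs, hcs⟩ := hc
    obtain ⟨n, hn⟩ := ih s hs hcs
    exact ⟨n, fun c' h => ⟨s, hs, hn c' h⟩⟩

/-- Sequential compactness of the shift space along an ultrafilter. -/
lemma exists_ultrafilter_limit [Finite (DE G)] (U : Ultrafilter ℕ) (c : ℕ → ChainSp G) :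
    ∃ d : ChainSp G, ∀ i, ∀ᶠ n in U, (c n).1 i = d.1 i := by
  have h : ∀ i, ∃ e, ∀ᶠ n in U, (c n).1 i = e := fun i =>
    Ultrafilter.eventually_exists_iff.1 (Filter.Eventually.of_forall fun n => ⟨_, rfl⟩)
  choose d hd using h
  refine ⟨⟨d, fun i => ?_⟩, hd⟩
  obtain ⟨n, h₀, h₁⟩ := ((hd i).and (hd (i + 1))).exists
  rw [← h₀, ← h₁]
  exact (c n).2 i

lemma exists_mem_cylFun [Finite (DE G)] {F : ChainSp G → ℂ} (hF : IsLocallyConstant F) :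
    ∃ N, F ∈ cylFun G (N + 1) := by
  by_contra! h
  have h' : ∀ N, ∃ c c' : ChainSp G, (∀ i < N + 1, c.1 i = c'.1 i) ∧ F c ≠ F c' := by
    intro N
    have hN := h N
    simp only [cylFun, mem_ofPred_eq] at hN
    push Not at hN
    exact hN
  choose c c' hcc hne using h'
  obtain ⟨d, hd⟩ := exists_ultrafilter_limit (Filter.hyperfilter ℕ) c
  obtain ⟨n, hn⟩ := exists_cylinder_subset (hF.isOpen_fiber (F d)) (c := d) rfl
  have hlarge : ∀ᶠ N in (Filter.hyperfilter ℕ : Filter ℕ), n ≤ N :=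
    Nat.hyperfilter_le_atTop (Filter.eventually_ge_atTop n)
  have hagree : ∀ᶠ N in (Filter.hyperfilter ℕ : Filter ℕ), ∀ i ∈ Finset.range n,
      (c N).1 i = d.1 i := (Filter.eventually_all_finset _).2 fun i _ => hd i
  obtain ⟨N, hN, hNd⟩ := (hlarge.and hagree).exists
  have h₁ : F (c N) = F d := hn _ fun i hi => hNd i (Finset.mem_range.2 hi)
  have h₂ : F (c' N) = F d := hn _ fun i hi =>
    (hcc N i (by omega)).symm.trans (hNd i (Finset.mem_range.2 hi))
  exact hne N (h₁.trans h₂.symm)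

lemma transfer_mem_cylFun [Finite (DE G)] {N : ℕ} {F : ChainSp G → ℂ}
    (hF : F ∈ cylFun G (N + 2)) : transfer G F ∈ cylFun G (N + 1) := by
  have := Fintype.ofFinite (DE G)
  intro c c' h
  rw [transfer_eq_sum, transfer_eq_sum, h 0 N.succ_pos]
  refine Finset.sum_congr rfl fun e he => ?_
  have he' : Follows G e (c'.1 0) := by simpa using he
  have he : Follows G e (c.1 0) := by rwa [h 0 N.succ_pos]
  refine hF _ _ fun i hi => ?_
  cases i with
  | zero => rw [cons_zero he, cons_zero he']
  | succ i => rw [cons_succ he, cons_succ he', h i (by omega)]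

lemma transfer_mem_cylFun_one [Finite (DE G)] {F : ChainSp G → ℂ}
    (hF : F ∈ cylFun G 1) : transfer G F ∈ cylFun G 1 :=
  transfer_mem_cylFun (cylFun_mono one_le_two hF)

variable (G) in
/-- The transfer operator as a linear endomorphism of the locally constant functions. -/
noncomputable def transferEnd [Finite (DE G)] : Module.End ℂ (ClcP G) where
  toFun F := ⟨transfer G F.1, by
    obtain ⟨N, hN⟩ := exists_mem_cylFun F.2
    exact isLocallyConstant_of_mem_cylFun 
      (transfer_mem_cylFun (cylFun_mono (N + 1).le_succ hN))⟩
  map_add' F F' := by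
    have := Fintype.ofFinite (DE G)
    ext c
    simp [transfer_eq_sum, Finset.sum_add_distrib]
  map_smul' a F := by
    have := Fintype.ofFinite (DE G)
    ext c
    simp [transfer_eq_sum, Finset.mul_sum]

lemma transferEnd_apply [Finite (DE G)] (F : ClcP G) : (transferEnd G F).1 = transfer G F.1 := rfl

lemma pairPc_transfer [Finite (DE G)] (lam : DualPc G) (F : ClcP G) :
    pairPc G lam (transfer G F.1) = lam (transferEnd G F) :=
  dif_pos (transferEnd G F).2

/-- Pull back a function on edges to chains along `c ↦ op (c 0)`. -/
def edgeToChain : (DE G → ℂ) →ₗ[ℂ] (ChainSp G → ℂ) where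
  toFun f c := f (op (c.1 0))
  map_add' _ _ := rfl
  map_smul' _ _ := rfl

lemma edgeToChain_mem_cylFun (f : DE G → ℂ) : edgeToChain f ∈ cylFun G 1 :=
  fun _ _ h => congrArg (fun e => f (op e)) (h 0 one_pos)

lemma transfer_edgeToChain [Finite (DE G)] (f : DE G → ℂ) (c : ChainSp G) :
    transfer G (edgeToChain f) c = edgeLap G f (op (c.1 0)) := by
  have := Fintype.ofFinite (DE G)
  rw [transfer_eq_sum, edgeLap_eq_sum]
  refine Finset.sum_bij' (fun e _ => op e) (fun e _ => op e) ?_ ?_ (fun _ _ => rfl)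
    (fun _ _ => rfl) ?_
  · intro e he
    simpa [follows_op_op] using he
  · intro e he
    simpa [follows_op_op (e := op e), ← follows_op_op (e' := c.1 0)] using he
  · intro e he
    have he : Follows G e (c.1 0) := by simpa using he
    exact congrArg (fun e => f (op e)) (cons_zero he)

lemma mem_cylFun_one_of_eigen [Finite (DE G)] {z : ℂ} (hz : z ≠ 0) {F : ChainSp G → ℂ}
    (hF : IsLocallyConstant F) (h : ∀ c, transfer G F c = z * F c) : F ∈ cylFun G 1 := by
  obtain ⟨N, hN⟩ := exists_mem_cylFun hF
  induction N with
  | zero => exact hN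
  | succ N ih =>
    refine ih fun c c' hc => mul_left_cancel₀ hz ?_
    rw [← h, ← h]
    exact transfer_mem_cylFun hN c c' hc

lemma edgeToChain_bijOn [Finite (DE G)] (hnd : ∀ x : X, 2 ≤ deg G x) {z : ℂ} (hz : z ≠ 0) :
    BijOn (edgeToChain (G := G)) (edgeEig G z)
      {F | IsLocallyConstant F ∧ ∀ c, transfer G F c = z * F c} := by
  choose chain hchain using exists_chain hnd
  refine ⟨fun f hf => ⟨isLocallyConstant_of_mem_cylFun (edgeToChain_mem_cylFun f), fun c => ?_⟩,
    fun f _ f' _ h => funext fun e => ?_, fun F hF => ?_⟩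
  · rw [transfer_edgeToChain, hf]
    rfl
  · simpa [edgeToChain, hchain] using congrFun h (chain (op e))
  · have hcyl := mem_cylFun_one_of_eigen hz hF.1 hF.2
    have hFeq : edgeToChain (fun e => F (chain (op e))) = F := funext fun c =>
      hcyl _ _ fun i hi => by
        obtain rfl : i = 0 := by omega
        exact hchain _
    refine ⟨_, fun e => ?_, hFeq⟩
    have h := transfer_edgeToChain (fun e => F (chain (op e))) (chain (op e))
    rw [hFeq, hF.2, hchain, op_op] at h
    exact h.symm

variable (G) in
/-- The indicator function of the chains starting with `e`. -/
noncomputable def startInd (e : DE G) : ClcP G :=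
  ⟨fun c => if c.1 0 = e then 1 else 0, isLocallyConstant_of_mem_cylFun (N := 1) fun _ _ h => by
    simp only [h 0 one_pos]⟩

lemma transferEnd_startInd [Fintype (DE G)] (e : DE G) :
    transferEnd G (startInd G e) = ∑ e' with Follows G e e', startInd G e' := by
  ext c
  rw [transferEnd_apply, transfer_eq_sum]
  have h : ∀ e' ∈ Finset.univ.filter (fun e' => Follows G e' (c.1 0)),
      (startInd G e).1 (cons e' c) = if e' = e then 1 else 0 := by
    intro e' he'
    simp only [startInd, cons_zero (Finset.mem_filter.1 he').2]
  rw [Finset.sum_congr rfl h]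
  simp [startInd, Finset.sum_apply]

lemma eq_sum_startInd [Fintype (DE G)] {chain : DE G → ChainSp G}
    (hchain : ∀ e, (chain e).1 0 = e) {F : ClcP G} (hF : F.1 ∈ cylFun G 1) :
    F = ∑ e, F.1 (chain e) • startInd G e := by
  ext c
  have h : F.1 c = F.1 (chain (c.1 0)) := hF _ _ fun i hi => by
    obtain rfl : i = 0 := by omega
    exact (hchain _).symm
  simp [startInd, Finset.sum_apply, h]

variable (G) in
/-- Restrict a functional on locally constant functions to the indicators of first edges. -/
noncomputable def dualToEdge : DualPc G →ₗ[ℂ] (DE G → ℂ) where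
  toFun lam e := lam (startInd G e)
  map_add' _ _ := rfl
  map_smul' _ _ := rfl

/-- A pointwise eventually constant sequence of functionals has a limit functional. -/
lemma exists_eventual_dual {V : Type*} [AddCommGroup V] [Module ℂ V] (φ : ℕ → Module.Dual ℂ V)
    (h : ∀ v, ∃ a, ∀ᶠ n in Filter.atTop, φ n v = a) :
    ∃ lam : Module.Dual ℂ V, ∀ v, ∀ᶠ n in Filter.atTop, φ n v = lam v := by
  choose a ha using h
  refine ⟨⟨⟨a, fun v w => ?_⟩, fun r v => ?_⟩, ha⟩
  · obtain ⟨n, ⟨h₁, h₂⟩, h₃⟩ := (((ha v).and (ha w)).and (ha (v + w))).exists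
    rw [← h₁, ← h₂, ← h₃, map_add]
  · obtain ⟨n, h₁, h₂⟩ := ((ha v).and (ha (r • v))).exists
    simp only [← h₁, ← h₂, map_smul, RingHom.id_apply]

/-- A functional that is an eigenfunctional on functions of the first edge extends to an
eigenfunctional of the dual transfer operator. -/
lemma exists_eigen_extension [Finite (DE G)] {z : ℂ} (hz : z ≠ 0) (mu : DualPc G)
    (hmu : ∀ F : ClcP G, F.1 ∈ cylFun G 1 → mu (transferEnd G F) = z * mu F) :
    ∃ lam : DualPc G, (∀ F, lam (transferEnd G F) = z * lam F) ∧
      ∀ F : ClcP G, F.1 ∈ cylFun G 1 → lam F = mu F := by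
  let φ : ℕ → DualPc G := fun n => (z⁻¹) ^ n • mu ∘ₗ (transferEnd G ^ n)
  have hsucc : ∀ n F, φ n (transferEnd G F) = z * φ (n + 1) F := by
    intro n F
    simp only [φ, LinearMap.smul_apply, LinearMap.comp_apply, pow_succ, Module.End.mul_apply,
      smul_eq_mul]
    field_simp
  have hone : ∀ n (F : ClcP G), F.1 ∈ cylFun G 1 → φ n F = mu F := by
    intro n
    induction n with
    | zero => intro F _; simp [φ]
    | succ n ih =>
      intro F hF
      refine mul_left_cancel₀ hz ?_
      rw [← hsucc, ih _ (transfer_mem_cylFun_one hF), hmu F hF]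
  have hev : ∀ (N : ℕ) (F : ClcP G), F.1 ∈ cylFun G (N + 1) →
      ∃ a, ∀ᶠ n in Filter.atTop, φ n F = a := by
    intro N
    induction N with
    | zero => exact fun F hF => ⟨mu F, Filter.Eventually.of_forall fun n => hone n F hF⟩
    | succ N ih =>
      intro F hF
      obtain ⟨a, ha⟩ := ih (transferEnd G F) (transfer_mem_cylFun hF)
      obtain ⟨n₀, hn₀⟩ := Filter.eventually_atTop.1 ha
      refine ⟨z⁻¹ * a, Filter.eventually_atTop.2 ⟨n₀ + 1, fun n hn => ?_⟩⟩
      obtain ⟨m, rfl⟩ : ∃ m, n = m + 1 := ⟨n - 1, by omega⟩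
      rw [← hn₀ m (by omega), hsucc, inv_mul_cancel_left₀ hz]
  obtain ⟨lam, hlam⟩ := exists_eventual_dual φ fun F =>
    (exists_mem_cylFun F.2).elim fun N hN => hev N F hN
  refine ⟨lam, fun F => ?_, fun F hF => ?_⟩
  · obtain ⟨n, h₁, h₂⟩ := ((hlam (transferEnd G F)).and
      ((Filter.tendsto_add_atTop_nat 1).eventually (hlam F))).exists
    rw [← h₁, ← h₂, hsucc]
  · obtain ⟨n, hn⟩ := (hlam F).exists
    rw [← hn, hone n F hF]

lemma edgeLap_dualToEdge [Finite (DE G)] (lam : DualPc G) (e : DE G) :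
    edgeLap G (dualToEdge G lam) e = lam (transferEnd G (startInd G e)) := by
  have := Fintype.ofFinite (DE G)
  rw [edgeLap_eq_sum, transferEnd_startInd, map_sum]
  rfl

lemma startInd_mem_cylFun (e : DE G) : (startInd G e).1 ∈ cylFun G 1 := fun _ _ h => by
  simp only [startInd, h 0 one_pos]

lemma dual_ext_cylFun_one [Finite (DE G)] (hnd : ∀ x : X, 2 ≤ deg G x) {lam mu : DualPc G}
    (h : ∀ e, lam (startInd G e) = mu (startInd G e)) {F : ClcP G} (hF : F.1 ∈ cylFun G 1) :
    lam F = mu F := by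
  have := Fintype.ofFinite (DE G)
  choose chain hchain using exists_chain hnd
  rw [eq_sum_startInd hchain hF]
  simp [h]

lemma dualToEdge_bijOn [Finite (DE G)] (hnd : ∀ x : X, 2 ≤ deg G x) {z : ℂ} (hz : z ≠ 0) :
    BijOn (dualToEdge G) {lam | ∀ F, lam (transferEnd G F) = z * lam F} (edgeEig G z) := by
  have := Fintype.ofFinite (DE G)
  choose chain hchain using exists_chain hnd
  refine ⟨fun lam hlam e => ?_, fun lam hlam mu hmu h => ?_, fun f hf => ?_⟩
  · rw [edgeLap_dualToEdge, hlam]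
    rfl
  · have key : ∀ (N : ℕ) (F : ClcP G), F.1 ∈ cylFun G (N + 1) → lam F = mu F := by
      intro N
      induction N with
      | zero => exact fun F hF => dual_ext_cylFun_one hnd (congrFun h) hF
      | succ N ih =>
        intro F hF
        refine mul_left_cancel₀ hz ?_
        rw [← hlam, ← hmu, ih _ (transfer_mem_cylFun hF)]
    ext F
    exact (exists_mem_cylFun F.2).elim fun N hN => key N F hN
  · let mu : DualPc G := ∑ e, f e • (LinearMap.proj (chain e)).comp (ClcP G).subtype
    have hmu : dualToEdge G mu = f := by
      ext e
      simp [dualToEdge, mu, startInd, hchain]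
    obtain ⟨lam, hlam, hext⟩ := exists_eigen_extension hz mu fun F hF => by
      refine dual_ext_cylFun_one hnd (lam := mu ∘ₗ transferEnd G) (mu := z • mu) (fun e => ?_) hF
      have h := edgeLap_dualToEdge mu e
      rw [hmu, hf, ← hmu] at h
      exact h.symm
    refine ⟨lam, hlam, ?_⟩
    rw [← hmu]
    exact funext fun e => hext _ (startInd_mem_cylFun e)

lemma AreLinIso.of_linearMap {M N : Type} [AddCommMonoid M] [Module ℂ M] [AddCommMonoid N]
    [Module ℂ N] (φ : M →ₗ[ℂ] N) {A : Set M} {B : Set N} (h : BijOn φ A B) : AreLinIso A B :=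
  ⟨φ, h, fun a _ b _ => map_add φ a b, fun c a _ => map_smul φ c a⟩

lemma AreLinIso.symm_of_linearMap {M N : Type} [AddCommMonoid M] [Module ℂ M] [AddCommMonoid N]
    [Module ℂ N] (φ : M →ₗ[ℂ] N) {A : Submodule ℂ M} {B : Set N} (h : BijOn φ A B) :
    AreLinIso B (A : Set M) := by
  have hinv := h.invOn_invFunOn
  have hmaps := h.surjOn.mapsTo_invFunOn
  refine ⟨_, h.symm hinv.symm, fun a ha b hb => ?_, fun c a ha => ?_⟩
  · have hs := A.add_mem (hmaps ha) (hmaps hb)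
    rw [← hinv.1 hs, map_add, hinv.2 ha, hinv.2 hb]
  · have hs := A.smul_mem c (hmaps ha)
    rw [← hinv.1 hs, map_smul, hinv.2 ha]

/-- Quantum-classical correspondence for finite graphs: for every
`z ≠ 0` the spaces `E_z(Δᵉ; Maps(E, ℂ))`, `E_z(L; C^lc(𝔓))` and `E_z(L'; D'(𝔓))` are
pairwise linearly isomorphic. -/
theorem statement13 {X : Type} [Finite X] (G : SimpleGraph X) (hconn : G.Connected)
    (hnd : ∀ x : X, 2 ≤ deg G x) (z : ℂ) (hz : z ≠ 0) :
    AreLinIso (edgeEig G z)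
      {F : ChainSp G → ℂ | IsLocallyConstant F ∧ ∀ c, transfer G F c = z * F c} ∧
    AreLinIso {F : ChainSp G → ℂ | IsLocallyConstant F ∧ ∀ c, transfer G F c = z * F c}
      {lam : DualPc G | ∀ f : ↥(ClcP G), pairPc G lam (transfer G f.1) = z * lam f} ∧
    AreLinIso (edgeEig G z)
      {lam : DualPc G | ∀ f : ↥(ClcP G), pairPc G lam (transfer G f.1) = z * lam f} := by
  have hset : {lam : DualPc G | ∀ f : ↥(ClcP G), pairPc G lam (transfer G f.1) = z * lam f} =
      (Module.End.eigenspace (transferEnd G).dualMap z : Set (DualPc G)) := by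
    ext lam
    simp only [mem_ofPred_eq, pairPc_transfer, SetLike.mem_coe, Module.End.mem_eigenspace_iff,
      LinearMap.ext_iff]
    rfl
  have hdual := dualToEdge_bijOn hnd hz
  simp only [← pairPc_transfer] at hdual
  have hedge := edgeToChain_bijOn hnd hz
  rw [hset] at hdual ⊢
  exact ⟨.of_linearMap _ hedge,
    .symm_of_linearMap (edgeToChain ∘ₗ dualToEdge G) (hedge.comp hdual),
    .symm_of_linearMap _ hdual⟩

end GraphQCC
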